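/- arXiv:2001.03198 — 6 statements merged into one kernel-verified Lean document; each statement's English description precedes it below -/
import Mathlib

section
/- Let ψ_c, ψ_e : ℝ → ℝ be convex differentiable functions and set ψ := ψ_c − ψ_e. Then for all a, b ∈ ℝ one has ψ(b) − ψ(a) ≤ (ψ_c'(b) − ψ_e'(a)) · (b − a). -/
/-- A convex function lies above its tangent line at any point of differentiability. -/
theorem ConvexOn.deriv_mul_sub_le_sub {S : Set ℝ} {f : ℝ → ℝ} {x y : ℝ}
    (hf : ConvexOn ℝ S f) (hx : x ∈ S) (hy : y ∈ S) (hd : DifferentiableAt ℝ f x) :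
    deriv f x * (y - x) ≤ f y - f x := by
  rcases lt_trichotomy x y with h | rfl | h
  · have hs := hf.deriv_le_slope hx hy h hd
    rwa [slope_def_field, le_div_iff₀ (sub_pos.2 h)] at hs
  · simp
  · have hs := hf.slope_le_deriv hy hx h hd
    rw [slope_def_field, div_le_iff₀ (sub_pos.2 h)] at hs
    linarith

/-- Pointwise convex–concave splitting inequality: for `ψ = ψc - ψe` with `ψc, ψe`
convex and differentiable, `ψ(b) - ψ(a) ≤ (ψc'(b) - ψe'(a)) (b - a)`. -/
theorem convex_concave_splitting
    (ψc ψe : ℝ → ℝ)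
    (hc : ConvexOn ℝ Set.univ ψc) (he : ConvexOn ℝ Set.univ ψe)
    (hdc : Differentiable ℝ ψc) (hde : Differentiable ℝ ψe)
    (a b : ℝ) :
    (ψc b - ψe b) - (ψc a - ψe a) ≤ (deriv ψc b - deriv ψe a) * (b - a) := by
  have h₁ := hc.deriv_mul_sub_le_sub (Set.mem_univ b) (Set.mem_univ a) (hdc b)
  have h₂ := he.deriv_mul_sub_le_sub (Set.mem_univ a) (Set.mem_univ b) (hde a)
  linarith
end

section
/- Let V be a real inner product space, let a, b ∈ V with ‖a‖ = ‖b‖ = 1, let s, t ∈ ℝ, and let κ > 0. Then both inequalities hold: (κ − 1)(s − t)² + ‖s·a − t·b‖² ≤ κ(s − t)² + ((s² + t²)/2)‖a − b‖², and (κ − 1)(|s| − |t|)² + ‖ |s|·a − |t|·b ‖² ≤ κ(s − t)² + ((s² + t²)/2)‖a − b‖². -/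
/-- For unit vectors, the squared distance between two multiples splits into a part from the
scalars and a part from the directions. -/
lemma norm_smul_sub_smul_sq_of_unit {V : Type*} [NormedAddCommGroup V] [InnerProductSpace ℝ V]
    {a b : V} (ha : ‖a‖ = 1) (hb : ‖b‖ = 1) (s t : ℝ) :
    ‖s • a - t • b‖ ^ 2 = (s - t) ^ 2 + s * t * ‖a - b‖ ^ 2 := by
  rw [norm_sub_sq_real, norm_sub_sq_real, norm_smul, norm_smul, real_inner_smul_left,
    real_inner_smul_right, ha, hb, mul_one, mul_one, Real.norm_eq_abs, Real.norm_eq_abs,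
    sq_abs, sq_abs]
  ring

lemma ericksen_energy_le_of_unit {V : Type*} [NormedAddCommGroup V] [InnerProductSpace ℝ V]
    {a b : V} (ha : ‖a‖ = 1) (hb : ‖b‖ = 1) (s t κ : ℝ) :
    (κ - 1) * (s - t) ^ 2 + ‖s • a - t • b‖ ^ 2
      ≤ κ * (s - t) ^ 2 + ((s ^ 2 + t ^ 2) / 2) * ‖a - b‖ ^ 2 := by
  rw [norm_smul_sub_smul_sq_of_unit ha hb]
  linarith [mul_nonneg (sq_nonneg (s - t)) (sq_nonneg ‖a - b‖)]

/-- Pointwise inequalities for unit vectors underlying the discrete energy inequalities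
of the Ericksen model. -/
theorem ericksen_discrete_energy_inequalities
    {V : Type*} [NormedAddCommGroup V] [InnerProductSpace ℝ V]
    (a b : V) (ha : ‖a‖ = 1) (hb : ‖b‖ = 1) (s t : ℝ) (κ : ℝ) (hκ : 0 < κ) :
    ((κ - 1) * (s - t) ^ 2 + ‖s • a - t • b‖ ^ 2
        ≤ κ * (s - t) ^ 2 + ((s ^ 2 + t ^ 2) / 2) * ‖a - b‖ ^ 2) ∧
    ((κ - 1) * (|s| - |t|) ^ 2 + ‖|s| • a - |t| • b‖ ^ 2
        ≤ κ * (s - t) ^ 2 + ((s ^ 2 + t ^ 2) / 2) * ‖a - b‖ ^ 2) := by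
  refine ⟨ericksen_energy_le_of_unit ha hb s t κ, ?_⟩
  have h := ericksen_energy_le_of_unit ha hb |s| |t| κ
  rw [sq_abs s, sq_abs t] at h
  have habs : (|s| - |t|) ^ 2 ≤ (s - t) ^ 2 := sq_le_sq.2 (abs_abs_sub_abs_le s t)
  exact h.trans (by gcongr)
end

section
/- Let d ≥ 1, let E be a real normed space, and let s : E → ℝ and Θ : E → Matrix (Fin d) (Fin d) ℝ be differentiable at a point x. Assume trace(Θ(y)) = 1 and ‖Θ(y)‖_F = 1 for all y ∈ E, where ‖·‖_F is the Frobenius norm. Define Q(y) := s(y) · (Θ(y) − (1/d)·I). Then Q is differentiable at x and for every direction v ∈ E: ‖DQ(x)v‖_F² = ((d−1)/d) (Ds(x)v)² + s(x)² ‖DΘ(x)v‖_F². -/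
attribute [local instance] Matrix.frobeniusNormedAddCommGroup Matrix.frobeniusNormedSpace

/-- The squared Frobenius norm of a real matrix as a trace. -/
theorem Matrix.frobenius_norm_sq_eq_trace {m n : Type*} [Fintype m] [Fintype n]
    (A : Matrix m n ℝ) : ‖A‖ ^ 2 = (A * A.transpose).trace := by
  rw [Matrix.frobenius_norm_def, ← Real.sqrt_eq_rpow, Real.sq_sqrt (by positivity)]
  simp [Matrix.trace, Matrix.mul_apply, sq]

/-- Entries of a matrix-valued map differentiable for the Frobenius norm are differentiable. -/
theorem HasFDerivAt.frobenius_entry {m n E : Type*} [Fintype m] [Fintype n]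
    [NormedAddCommGroup E] [NormedSpace ℝ E] {M : E → Matrix m n ℝ} {M' : E →L[ℝ] Matrix m n ℝ}
    {x : E} (h : HasFDerivAt M M' x) (i : m) (j : n) :
    HasFDerivAt (fun y => M y i j)
      ((Matrix.entryLinearMap ℝ ℝ i j).toContinuousLinearMap.comp M') x :=
  (Matrix.entryLinearMap ℝ ℝ i j).toContinuousLinearMap.hasFDerivAt.comp x h

/-- The derivative of a matrix field of constant trace is traceless. -/
theorem HasFDerivAt.trace_eq_zero_of_trace_const {n E : Type*} [Fintype n]
    [NormedAddCommGroup E] [NormedSpace ℝ E] {M : E → Matrix n n ℝ} {M' : E →L[ℝ] Matrix n n ℝ}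
    {x : E} (h : HasFDerivAt M M' x) {c : ℝ} (hc : ∀ y, (M y).trace = c) (v : E) :
    (M' v).trace = 0 := by
  have hsum := HasFDerivAt.fun_sum (u := Finset.univ) fun i _ => h.frobenius_entry i i
  have hconst : (fun y => ∑ i, M y i i) = fun _ => c := funext hc
  rw [hconst] at hsum
  simpa [Matrix.trace] using congrArg (fun L => L v) (hsum.unique (hasFDerivAt_const c x))

/-- The derivative of a matrix field of constant Frobenius norm is orthogonal to the field. -/
theorem HasFDerivAt.trace_mul_transpose_eq_zero_of_norm_const {m n E : Type*} [Fintype m]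
    [Fintype n] [NormedAddCommGroup E] [NormedSpace ℝ E] {M : E → Matrix m n ℝ}
    {M' : E →L[ℝ] Matrix m n ℝ} {x : E} (h : HasFDerivAt M M' x) {c : ℝ}
    (hc : ∀ y, ‖M y‖ = c) (v : E) : (M x * (M' v).transpose).trace = 0 := by
  have hsum := HasFDerivAt.fun_sum (u := Finset.univ) fun i _ =>
    HasFDerivAt.fun_sum (u := Finset.univ) fun j _ =>
      (h.frobenius_entry i j).mul (h.frobenius_entry i j)
  have hconst : (fun y => ∑ i, ∑ j, M y i j * M y i j) = fun _ => c ^ 2 := by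
    funext y
    rw [← hc y, Matrix.frobenius_norm_sq_eq_trace]
    simp [Matrix.trace, Matrix.mul_apply]
  have hzero := congrArg (fun L => L v)
    ((hsum.congr_of_eventuallyEq (.of_eq hconst.symm)).unique (hasFDerivAt_const (c ^ 2) x))
  simp only [sum_apply, add_apply,
    smul_apply, ContinuousLinearMap.comp_apply,
    LinearMap.coe_toContinuousLinearMap', Matrix.entryLinearMap_apply, smul_eq_mul,
    Finset.sum_add_distrib, zero_apply] at hzero
  simp only [Matrix.trace, Matrix.diag_apply, Matrix.mul_apply, Matrix.transpose_apply]
  linarith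

/-- For a uniaxial `Q`-tensor field `Q = s (Θ - (1/d) I)` with `Θ` a line field
(`trace Θ = 1`, `‖Θ‖_F = 1`), one has
`‖DQ(x)v‖_F² = ((d-1)/d) (Ds(x)v)² + s(x)² ‖DΘ(x)v‖_F²`. -/
theorem uniaxial_Q_tensor_gradient_identity
    {d : ℕ} (hd : 1 ≤ d)
    {E : Type*} [NormedAddCommGroup E] [NormedSpace ℝ E]
    (s : E → ℝ) (Θ : E → Matrix (Fin d) (Fin d) ℝ) (x : E)
    (hs : DifferentiableAt ℝ s x) (hΘ : DifferentiableAt ℝ Θ x)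
    (htr : ∀ y, (Θ y).trace = 1) (hnorm : ∀ y, ‖Θ y‖ = 1) :
    DifferentiableAt ℝ (fun y => s y • (Θ y - ((1 : ℝ) / d) • (1 : Matrix (Fin d) (Fin d) ℝ))) x ∧
    ∀ v : E,
      ‖fderiv ℝ (fun y => s y • (Θ y - ((1 : ℝ) / d) • (1 : Matrix (Fin d) (Fin d) ℝ))) x v‖ ^ 2
        = (((d : ℝ) - 1) / d) * (fderiv ℝ s x v) ^ 2 + (s x) ^ 2 * ‖fderiv ℝ Θ x v‖ ^ 2 := by
  have hshift := hΘ.hasFDerivAt.sub_const (((1 : ℝ) / d) • (1 : Matrix (Fin d) (Fin d) ℝ))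
  have hQ := hs.hasFDerivAt.fun_smul hshift
  refine ⟨hQ.differentiableAt, fun v => ?_⟩
  have htrace := hΘ.hasFDerivAt.trace_eq_zero_of_trace_const htr v
  have horth := hΘ.hasFDerivAt.trace_mul_transpose_eq_zero_of_norm_const hnorm v
  have horth' : (fderiv ℝ Θ x v * (Θ x).transpose).trace = 0 := by
    rw [← Matrix.trace_transpose, Matrix.transpose_mul, Matrix.transpose_transpose, horth]
  have hunit : (Θ x * (Θ x).transpose).trace = 1 := by
    rw [← Matrix.frobenius_norm_sq_eq_trace, hnorm, one_pow]
  have hd0 : (d : ℝ) ≠ 0 := by positivity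
  have hQv : fderiv ℝ
      (fun y => s y • (Θ y - ((1 : ℝ) / d) • (1 : Matrix (Fin d) (Fin d) ℝ))) x v =
      s x • fderiv ℝ Θ x v +
        fderiv ℝ s x v • (Θ x - ((1 : ℝ) / d) • (1 : Matrix (Fin d) (Fin d) ℝ)) :=
    congrArg (fun L => L v) hQ.fderiv
  rw [hQv, Matrix.frobenius_norm_sq_eq_trace, Matrix.frobenius_norm_sq_eq_trace]
  simp only [Matrix.transpose_add, Matrix.transpose_sub, Matrix.transpose_smul,
    Matrix.transpose_one, Matrix.add_mul, Matrix.mul_add, Matrix.sub_mul, Matrix.mul_sub,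
    Matrix.smul_mul, Matrix.mul_smul, Matrix.one_mul, Matrix.mul_one, Matrix.trace_add,
    Matrix.trace_sub, Matrix.trace_smul, Matrix.trace_transpose, Matrix.trace_one,
    Fintype.card_fin, smul_eq_mul, htr, htrace, horth, horth', hunit]
  field_simp
  ring
end

section
/- Let n : EuclideanSpace ℝ (Fin 3) → EuclideanSpace ℝ (Fin 3) be defined by n(x) = ‖x‖⁻¹ · x (with any value at x = 0). Then the function x ↦ ‖D n(x)‖², where D n(x) is the Fréchet derivative (taken to be 0 where n is not differentiable) and ‖·‖ the operator norm, IS Lebesgue-integrable on the unit ball {x : ‖x‖ < 1}. -/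
open MeasureTheory

/-- Radial projection onto the unit sphere is Lipschitz relative to `x` with constant `2 / ‖x‖`. -/
lemma norm_inv_norm_smul_sub_le {E : Type*} [NormedAddCommGroup E] [NormedSpace ℝ E] {x y : E}
    (hx : x ≠ 0) (hy : y ≠ 0) :
    ‖‖y‖⁻¹ • y - ‖x‖⁻¹ • x‖ ≤ 2 * ‖x‖⁻¹ * ‖y - x‖ := by
  have hx' : 0 < ‖x‖ := norm_pos_iff.2 hx
  have hy' : 0 < ‖y‖ := norm_pos_iff.2 hy
  have hsplit : ‖y‖⁻¹ • y - ‖x‖⁻¹ • x =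
      ((‖x‖ - ‖y‖) * (‖x‖⁻¹ * ‖y‖⁻¹)) • y + ‖x‖⁻¹ • (y - x) := by
    have hcoef : (‖x‖ - ‖y‖) * (‖x‖⁻¹ * ‖y‖⁻¹) = ‖y‖⁻¹ - ‖x‖⁻¹ := by field_simp
    rw [hcoef]
    module
  have hrad : ‖((‖x‖ - ‖y‖) * (‖x‖⁻¹ * ‖y‖⁻¹)) • y‖ = |‖x‖ - ‖y‖| * ‖x‖⁻¹ := by
    rw [norm_smul, Real.norm_eq_abs, abs_mul, abs_of_pos (by positivity : 0 < ‖x‖⁻¹ * ‖y‖⁻¹)]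
    field_simp
  have habs : |‖x‖ - ‖y‖| ≤ ‖y - x‖ := by
    rw [norm_sub_rev]
    exact abs_norm_sub_norm_le x y
  calc ‖‖y‖⁻¹ • y - ‖x‖⁻¹ • x‖
      ≤ |‖x‖ - ‖y‖| * ‖x‖⁻¹ + ‖x‖⁻¹ * ‖y - x‖ := by
        rw [hsplit, ← hrad]
        refine (norm_add_le _ _).trans_eq ?_
        rw [norm_smul ‖x‖⁻¹, norm_inv, norm_norm]
    _ ≤ ‖y - x‖ * ‖x‖⁻¹ + ‖x‖⁻¹ * ‖y - x‖ := by gcongr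
    _ = 2 * ‖x‖⁻¹ * ‖y - x‖ := by ring

lemma norm_fderiv_le_of_eq_inv_norm_smul {E : Type*} [NormedAddCommGroup E] [NormedSpace ℝ E]
    {n : E → E} (hn : ∀ x, x ≠ 0 → n x = ‖x‖⁻¹ • x) {x : E} (hx : x ≠ 0) :
    ‖fderiv ℝ n x‖ ≤ 2 * ‖x‖⁻¹ := by
  refine norm_fderiv_le_of_lip' ℝ (by positivity) ?_
  filter_upwards [isOpen_ne.mem_nhds hx] with y hy
  rw [hn y hy, hn x hx]
  exact norm_inv_norm_smul_sub_le hx hy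

/-- The hedgehog point defect `n(x) = x/‖x‖` in three dimensions has finite
one-constant Oseen–Frank energy: `‖Dn‖²` is integrable on the unit ball. -/
theorem point_defect_3d_finite_energy
    (n : EuclideanSpace ℝ (Fin 3) → EuclideanSpace ℝ (Fin 3))
    (hn : ∀ x, x ≠ 0 → n x = ‖x‖⁻¹ • x) :
    IntegrableOn (fun x => ‖fderiv ℝ n x‖ ^ 2) (Metric.ball 0 1) volume := by
  have hmeas : Measurable fun x => ‖fderiv ℝ n x‖ ^ 2 := (measurable_fderiv ℝ n).norm.pow_const 2
  refine integrableOn_ball_of_norm_le_rpow (C := 4) (α := 2) (by simp) (by simp; norm_num) ?_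
    hmeas.aestronglyMeasurable
  filter_upwards [ae_restrict_of_ae (Measure.ae_ne volume 0)] with x hx
  calc ‖‖fderiv ℝ n x‖ ^ 2‖ = ‖fderiv ℝ n x‖ ^ 2 := by simp
    _ ≤ (2 * ‖x‖⁻¹) ^ 2 := by
        gcongr
        exact norm_fderiv_le_of_eq_inv_norm_smul hn hx
    _ = 4 * ‖x‖ ^ (-2 : ℝ) := by
        rw [Real.rpow_neg (norm_nonneg x), Real.rpow_two]
        ring
end

section
/- Let Q be a real 3×3 symmetric matrix with trace(Q) = 0. Then 6 (trace(Q³))² ≤ (trace(Q²))³, and equality holds if and only if Q is uniaxial, i.e. there exist s ∈ ℝ and a unit vector n ∈ ℝ³ such that Q = s(n⊗n − (1/3)I). -/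
open Matrix

/-- A real symmetric matrix is orthogonally diagonalizable. -/
lemma exists_orthogonal_diagonalization {ι : Type*} [Fintype ι] [DecidableEq ι]
    {Q : Matrix ι ι ℝ} (hsymm : Qᵀ = Q) :
    ∃ (U : Matrix ι ι ℝ) (d : ι → ℝ), Uᵀ * U = 1 ∧ U * Uᵀ = 1 ∧ Q = U * diagonal d * Uᵀ := by
  have hQ : Q.IsHermitian := by rwa [IsHermitian, conjTranspose_eq_transpose_of_trivial]
  refine ⟨hQ.eigenvectorUnitary, hQ.eigenvalues, ?_, ?_, ?_⟩
  · simpa [star_eq_conjTranspose] using Unitary.coe_star_mul_self hQ.eigenvectorUnitary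
  · simpa [star_eq_conjTranspose] using Unitary.coe_mul_star_self hQ.eigenvectorUnitary
  · have h := hQ.spectral_theorem
    rw [Unitary.conjStarAlgAut_apply, star_eq_conjTranspose,
      conjTranspose_eq_transpose_of_trivial] at h
    exact h

lemma trace_conj_diagonal_pow {ι : Type*} [Fintype ι] [DecidableEq ι]
    {U V : Matrix ι ι ℝ} (h : V * U = 1) (h' : U * V = 1) (d : ι → ℝ) (k : ℕ) :
    ((U * diagonal d * V) ^ k).trace = ∑ i, d i ^ k := by
  have hpow : (U * diagonal d * V) ^ k = U * diagonal d ^ k * V :=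
    Units.conj_pow ⟨U, V, h', h⟩ (diagonal d) k
  rw [hpow, trace_mul_comm, ← mul_assoc, h, one_mul, diagonal_pow, trace_diagonal]
  simp

/-- An orthogonal conjugate of a diagonal matrix whose entries agree away from one index
is a rank-one perturbation of a scalar matrix. -/
lemma conj_diagonal_add_single {ι : Type*} [Fintype ι] [DecidableEq ι]
    {U : Matrix ι ι ℝ} (h : U * Uᵀ = 1) (a s : ℝ) (k : ι) :
    U * diagonal (fun i => a + if i = k then s else 0) * Uᵀ =
      a • (1 : Matrix ι ι ℝ) + s • vecMulVec (fun i => U i k) (fun i => U i k) := by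
  rw [← h]
  ext i j
  rw [mul_apply]
  simp only [mul_diagonal]
  simp [mul_apply, vecMulVec_apply, mul_add, Finset.sum_add_distrib,
    Finset.mul_sum, mul_comm, mul_left_comm]

/-- The discriminant identity for three reals with zero sum. -/
lemma sum_sq_cube_sub_six_mul_sum_cube_sq {a b c : ℝ} (h : a + b + c = 0) :
    (a ^ 2 + b ^ 2 + c ^ 2) ^ 3 - 6 * (a ^ 3 + b ^ 3 + c ^ 3) ^ 2 =
      2 * ((a - b) * (b - c) * (a - c)) ^ 2 := by
  obtain rfl : c = -a - b := by linarith
  ring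

lemma six_mul_trace_cube_sq_of_uniaxial (s : ℝ) {n : Fin 3 → ℝ} (hn : ∑ i, (n i) ^ 2 = 1)
    {Q : Matrix (Fin 3) (Fin 3) ℝ}
    (hQ : Q = s • (vecMulVec n n - ((1 : ℝ) / 3) • (1 : Matrix (Fin 3) (Fin 3) ℝ))) :
    6 * ((Q ^ 3).trace) ^ 2 = ((Q ^ 2).trace) ^ 3 := by
  have hdot : n ⬝ᵥ n = 1 := by simpa [dotProduct, sq] using hn
  have htr : (vecMulVec n n).trace = 1 := by rw [trace_vecMulVec, hdot]
  have hidem : vecMulVec n n * vecMulVec n n = vecMulVec n n := by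
    rw [vecMulVec_mul_vecMulVec, hdot, one_smul]
  generalize vecMulVec n n = P at *
  have hsq : Q ^ 2 = s ^ 2 • ((1 / 3 : ℝ) • P + (1 / 9 : ℝ) • 1) := by
    rw [hQ, sq]
    simp only [smul_mul_assoc, mul_smul_comm, sub_mul, mul_sub, hidem, mul_one, one_mul]
    module
  have hcube : Q ^ 3 = s ^ 3 • ((1 / 3 : ℝ) • P - (1 / 27 : ℝ) • 1) := by
    rw [pow_succ, hsq, hQ]
    simp only [smul_mul_assoc, mul_smul_comm, add_mul, mul_sub, hidem, mul_one, one_mul]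
    module
  rw [hsq, hcube]
  simp only [trace_smul, trace_add, trace_sub, htr, trace_one, Fintype.card_fin, smul_eq_mul]
  push_cast
  ring

lemma uniaxial_of_eigenvalues {U : Matrix (Fin 3) (Fin 3) ℝ} (h : Uᵀ * U = 1) (h' : U * Uᵀ = 1)
    {d : Fin 3 → ℝ} (a : ℝ) (k : Fin 3) (hd : d = fun i => a + if i = k then -3 * a else 0) :
    ∃ (s : ℝ) (n : Fin 3 → ℝ), (∑ i, (n i) ^ 2 = 1) ∧
      U * diagonal d * Uᵀ =
        s • (vecMulVec n n - ((1 : ℝ) / 3) • (1 : Matrix (Fin 3) (Fin 3) ℝ)) := by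
  refine ⟨-3 * a, fun i => U i k, ?_, ?_⟩
  · simpa [mul_apply, sq] using congrFun (congrFun h k) k
  · rw [hd, conj_diagonal_add_single h']
    module

/-- For a symmetric traceless real 3×3 matrix `Q`, `6 (tr Q³)² ≤ (tr Q²)³`, with
equality iff `Q` is uniaxial, i.e. `Q = s(n⊗n − (1/3)I)` for some `s` and unit `n`. -/
theorem biaxiality_inequality
    (Q : Matrix (Fin 3) (Fin 3) ℝ) (hsymm : Qᵀ = Q) (htr : Q.trace = 0) :
    6 * ((Q ^ 3).trace) ^ 2 ≤ ((Q ^ 2).trace) ^ 3 ∧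
    (6 * ((Q ^ 3).trace) ^ 2 = ((Q ^ 2).trace) ^ 3 ↔
      ∃ (s : ℝ) (n : Fin 3 → ℝ), (∑ i, (n i) ^ 2 = 1) ∧
        Q = s • (vecMulVec n n - ((1 : ℝ) / 3) • (1 : Matrix (Fin 3) (Fin 3) ℝ))) := by
  obtain ⟨U, d, h, h', rfl⟩ := exists_orthogonal_diagonalization hsymm
  have hsum : d 0 + d 1 + d 2 = 0 := by
    rw [← pow_one (U * diagonal d * Uᵀ), trace_conj_diagonal_pow h h'] at htr
    simpa [Fin.sum_univ_three] using htr
  have hdisc := sum_sq_cube_sub_six_mul_sum_cube_sq hsum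
  refine ⟨?_, fun heq => ?_, fun ⟨s, n, hn, hQ⟩ => six_mul_trace_cube_sq_of_uniaxial s hn hQ⟩
  · simp only [trace_conj_diagonal_pow h h', Fin.sum_univ_three]
    linarith [sq_nonneg ((d 0 - d 1) * (d 1 - d 2) * (d 0 - d 2))]
  · simp only [trace_conj_diagonal_pow h h', Fin.sum_univ_three] at heq
    have hzero : (d 0 - d 1) * (d 1 - d 2) * (d 0 - d 2) = 0 :=
      pow_eq_zero_iff two_ne_zero |>.mp (by linarith)
    rcases mul_eq_zero.mp hzero with hzero | h02
    · rcases mul_eq_zero.mp hzero with h01 | h12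
      · refine uniaxial_of_eigenvalues h h' (d 0) 2 (funext fun i => ?_)
        fin_cases i <;> simp <;> linarith
      · refine uniaxial_of_eigenvalues h h' (d 1) 0 (funext fun i => ?_)
        fin_cases i <;> simp <;> linarith
    · refine uniaxial_of_eigenvalues h h' (d 0) 1 (funext fun i => ?_)
      fin_cases i <;> simp <;> linarith
end

section
/- Let A ∈ ℝ, B > 0, C ∈ ℝ, and let Q be a real 3×3 symmetric matrix with trace(Q) = 0. Suppose Q satisfies the stationarity condition of the Landau–deGennes bulk potential on the space of symmetric traceless matrices: there exists μ ∈ ℝ such that A·Q − B·Q² + C·trace(Q²)·Q = μ·I. Then Q is either isotropic or uniaxial: there exist s ∈ ℝ and a unit vector n ∈ ℝ³ such that Q = s(n⊗n − (1/3)I). -/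
open Matrix

/-- An eigenvalue of a matrix satisfying `a Q - B Q² = μ I` satisfies the same equation. -/
lemma quadratic_of_mulVec_eq_smul {m : Type*} [Fintype m] [DecidableEq m] {a B μ x : ℝ}
    {Q : Matrix m m ℝ} (hQ : a • Q - B • Q ^ 2 = μ • (1 : Matrix m m ℝ))
    {v : m → ℝ} (hv : v ≠ 0) (hx : Q *ᵥ v = x • v) : a * x - B * x ^ 2 = μ := by
  have h := congrArg (· *ᵥ v) hQ
  simp only [sub_mulVec, smul_mulVec, pow_two, ← mulVec_mulVec, hx, mulVec_smul, one_mulVec,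
    smul_smul, ← sub_smul] at h
  linear_combination smul_left_injective ℝ hv h

/-- Three real roots of a nondegenerate quadratic cannot be distinct, so two of them,
indexed by the complement of some `k`, coincide. -/
lemma exists_eq_off_of_quadratic {a B μ : ℝ} (hB : B ≠ 0) {d : Fin 3 → ℝ}
    (hd : ∀ i, a * d i - B * d i ^ 2 = μ) :
    ∃ (k : Fin 3) (l : ℝ), ∀ i, i ≠ k → d i = l := by
  by_cases h01 : d 0 = d 1
  · exact ⟨2, d 0, fun i hi => by fin_cases i <;> simp_all⟩
  by_cases h02 : d 0 = d 2
  · exact ⟨1, d 0, fun i hi => by fin_cases i <;> simp_all⟩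
  have h1 : a - B * (d 0 + d 1) = 0 :=
    mul_left_cancel₀ (sub_ne_zero.2 h01) (by linear_combination hd 0 - hd 1)
  have h2 : a - B * (d 0 + d 2) = 0 :=
    mul_left_cancel₀ (sub_ne_zero.2 h02) (by linear_combination hd 0 - hd 2)
  have h12 : d 1 = d 2 := mul_left_cancel₀ hB (by linear_combination h2 - h1)
  exact ⟨0, d 1, fun i hi => by fin_cases i <;> simp_all⟩

/-- If all eigenvalues but the one at `k` equal `l`, then the matrix is a rank-one perturbation
of `l I` in the direction of the `k`-th eigenvector. -/
lemma mul_diagonal_mul_transpose_eq_of_eq_off {m : Type*} [Fintype m] [DecidableEq m]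
    {U : Matrix m m ℝ} (hU : U * Uᵀ = 1) {d : m → ℝ} {k : m} {l : ℝ}
    (hd : ∀ i, i ≠ k → d i = l) :
    U * diagonal d * Uᵀ = (d k - l) • vecMulVec (U.col k) (U.col k) + l • (1 : Matrix m m ℝ) := by
  have hdiag : diagonal d = (d k - l) • Matrix.single k k (1 : ℝ) + l • (1 : Matrix m m ℝ) := by
    ext i j
    by_cases hij : i = j
    · subst hij
      by_cases hik : i = k
      · subst hik
        simp
      · simp [hd i hik, Ne.symm hik]
    · have : ¬ (k = i ∧ k = j) := fun h => hij (h.1.symm.trans h.2)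
      simp [hij, this]
  rw [hdiag, Matrix.mul_add, Matrix.add_mul]
  simp only [mul_smul_comm, smul_mul_assoc, mul_one, hU]
  congr 2
  rw [Matrix.single_eq_single_vecMulVec_single, mul_vecMulVec, vecMulVec_mul]
  simp

/-- Critical points of the Landau–deGennes bulk potential are isotropic or uniaxial:
if a symmetric traceless 3×3 matrix `Q` satisfies
`A Q − B Q² + C tr(Q²) Q = μ I` for some Lagrange multiplier `μ`, with `B > 0`, then
`Q = s(n⊗n − (1/3)I)` for some `s ∈ ℝ` and unit vector `n`. -/
theorem LdG_bulk_critical_points_uniaxial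
    (A : ℝ) (B : ℝ) (hB : 0 < B) (C : ℝ)
    (Q : Matrix (Fin 3) (Fin 3) ℝ) (hsymm : Qᵀ = Q) (htr : Q.trace = 0)
    (hstat : ∃ μ : ℝ, A • Q - B • Q ^ 2 + (C * (Q ^ 2).trace) • Q
        = μ • (1 : Matrix (Fin 3) (Fin 3) ℝ)) :
    ∃ (s : ℝ) (n : Fin 3 → ℝ), (∑ i, (n i) ^ 2 = 1) ∧
      Q = s • (vecMulVec n n - ((1 : ℝ) / 3) • (1 : Matrix (Fin 3) (Fin 3) ℝ)) := by
  obtain ⟨μ, hμ⟩ := hstat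
  have hQ : (A + C * (Q ^ 2).trace) • Q - B • Q ^ 2 = μ • (1 : Matrix (Fin 3) (Fin 3) ℝ) := by
    rw [← hμ, add_smul]
    abel
  have hH : Q.IsHermitian := by rwa [IsHermitian, conjTranspose_eq_transpose_of_trivial]
  obtain ⟨k, l, hl⟩ := exists_eq_off_of_quadratic hB.ne' fun i =>
    quadratic_of_mulVec_eq_smul hQ
      (fun h => hH.eigenvectorBasis.orthonormal.ne_zero i (WithLp.ofLp_injective 2 h))
      (hH.mulVec_eigenvectorBasis i)
  set U : Matrix (Fin 3) (Fin 3) ℝ := hH.eigenvectorUnitary.1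
  have hU : U * Uᵀ = 1 := by
    simpa [star_eq_conjTranspose] using Unitary.coe_mul_star_self hH.eigenvectorUnitary
  have hU' : Uᵀ * U = 1 := mul_eq_one_comm.1 hU
  have hspec : Q = U * diagonal hH.eigenvalues * Uᵀ := by
    have h := hH.spectral_theorem
    rw [Unitary.conjStarAlgAut_apply] at h
    simpa [star_eq_conjTranspose, Function.comp_def] using h
  rw [mul_diagonal_mul_transpose_eq_of_eq_off hU hl] at hspec
  have hn : ∑ i, U.col k i ^ 2 = 1 := by
    simpa [mul_apply, pow_two] using congrFun (congrFun hU' k) k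
  refine ⟨hH.eigenvalues k - l, U.col k, hn, ?_⟩
  have htr' : hH.eigenvalues k - l + 3 * l = 0 := by
    rw [hspec, trace_add, trace_smul, trace_smul, trace_vecMulVec, trace_one] at htr
    have hdot : U.col k ⬝ᵥ U.col k = 1 := by simpa [dotProduct, pow_two] using hn
    rw [hdot] at htr
    simp at htr
    linarith
  have hl3 : l = -((hH.eigenvalues k - l) * (1 / 3)) := by linarith
  rw [smul_sub, smul_smul, sub_eq_add_neg, ← neg_smul, ← hl3]
  exact hspec
end
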